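/- Let (θ_A, c) ∈ Θ, let (θ_F, c') ∈ Θ, and let u, v be natural numbers with u ≥ 2, v ≥ 2, c < u, and c < v. Then the strict inequality θ_F(2·θ_A(2^u)) + θ_F(2·θ_A(2^v)) < 2^{θ_A(θ_F(4·u) + θ_F(4·v))} holds. -/

import Mathlib

/-- The inductively defined class Θ of pairs (θ, c): `(id, 0) ∈ Θ`;
if `(θ, c) ∈ Θ` then `(x ↦ 2·θ x, c) ∈ Θ`; and if `(θ, c) ∈ Θ` and `b ≥ 1`
then `(x ↦ b + θ x, c + b) ∈ Θ`. -/
inductive Theta : (ℕ → ℕ) → ℕ → Prop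
  | id : Theta (fun x => x) 0
  | double {θ : ℕ → ℕ} {c : ℕ} : Theta θ c → Theta (fun x => 2 * θ x) c
  | add {θ : ℕ → ℕ} {c : ℕ} (b : ℕ) : Theta θ c → 1 ≤ b →
      Theta (fun x => b + θ x) (c + b)

/-- Every member of `Theta` is affine, with constant term bounded by the slope times `c`. -/
theorem Theta.exists_affine {θ : ℕ → ℕ} {c : ℕ} (h : Theta θ c) :
    ∃ a r : ℕ, 1 ≤ a ∧ r ≤ a * c ∧ ∀ x, θ x = a * x + r := by
  induction h with
  | id => exact ⟨1, 0, le_rfl, by simp, by simp⟩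
  | double _ ih =>
    obtain ⟨a, r, ha, hr, h⟩ := ih
    exact ⟨2 * a, 2 * r, by omega, by nlinarith, fun x => by simp only [h]; ring⟩
  | add b _ _ ih =>
    obtain ⟨a, r, ha, hr, h⟩ := ih
    exact ⟨a, b + r, ha, by nlinarith, fun x => by simp only [h]; ring⟩

theorem four_mul_mul_two_pow_add_lt (n w s : ℕ) (hn : 1 ≤ n) (hw : 4 ≤ w) :
    4 * n * 2 ^ w + s < 2 ^ (4 * n * w + s) := by
  have hX : 1 ≤ 4 * n * 2 ^ w := Nat.mul_pos (by omega) (by positivity)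
  have hs : s + 1 ≤ 2 ^ s := Nat.lt_two_pow_self
  calc 4 * n * 2 ^ w + s ≤ 4 * n * 2 ^ w * (s + 1) := by nlinarith
    _ ≤ 4 * n * 2 ^ w * 2 ^ s := by gcongr
    _ < 2 ^ (4 * n) * 2 ^ w * 2 ^ s := by
      gcongr
      exact Nat.lt_two_pow_self
    _ = 2 ^ (4 * n + w + s) := by rw [pow_add, pow_add]
    _ ≤ 2 ^ (4 * n * w + s) := Nat.pow_le_pow_right (by norm_num) (by nlinarith)

theorem theta_rule20 (θA : ℕ → ℕ) (c : ℕ) (hA : Theta θA c)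
    (θF : ℕ → ℕ) (c' : ℕ) (hF : Theta θF c')
    (u v : ℕ) (hu : 2 ≤ u) (hv : 2 ≤ v) (hcu : c < u) (hcv : c < v) :
    θF (2 * θA (2 ^ u)) + θF (2 * θA (2 ^ v))
      < 2 ^ θA (θF (4 * u) + θF (4 * v)) := by
  obtain ⟨a, r, ha, hr, hθA⟩ := hA.exists_affine
  obtain ⟨p, s, hp, -, hθF⟩ := hF.exists_affine
  simp only [hθA, hθF]
  have hru : r ≤ a * 2 ^ u :=
    hr.trans (Nat.mul_le_mul_left a (hcu.trans Nat.lt_two_pow_self).le)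
  have hrv : r ≤ a * 2 ^ v :=
    hr.trans (Nat.mul_le_mul_left a (hcv.trans Nat.lt_two_pow_self).le)
  have hu4 : 2 ^ 2 ≤ 2 ^ u := Nat.pow_le_pow_right (by norm_num) hu
  have hv4 : 2 ^ 2 ≤ 2 ^ v := Nat.pow_le_pow_right (by norm_num) hv
  have hsum : 2 ^ u + 2 ^ v ≤ 2 ^ (u + v) := by
    rw [pow_add]
    nlinarith
  calc p * (2 * (a * 2 ^ u + r)) + s + (p * (2 * (a * 2 ^ v + r)) + s)
      ≤ p * (2 * (a * 2 ^ u + a * 2 ^ u)) + s + (p * (2 * (a * 2 ^ v + a * 2 ^ v)) + s) := by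
        gcongr
    _ = 4 * (p * a) * (2 ^ u + 2 ^ v) + 2 * s := by ring
    _ ≤ 4 * (p * a) * 2 ^ (u + v) + 2 * s := by gcongr
    _ < 2 ^ (4 * (p * a) * (u + v) + 2 * s) :=
        four_mul_mul_two_pow_add_lt _ _ _ (Nat.mul_pos hp ha) (by omega)
    _ ≤ 2 ^ (a * (p * (4 * u) + s + (p * (4 * v) + s)) + r) :=
        Nat.pow_le_pow_right (by norm_num) (by nlinarith [Nat.mul_le_mul_right s ha])
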